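/- Let n ≥ 5. Then G_2 is the unique second last graph in the S-order among 𝒢_n^1; that is, G_2 ≺_s K_n^1, and every connected n-vertex graph G with exactly one cut edge that is isomorphic to neither K_n^1 nor G_2 satisfies G ≺_s G_2. -/

import Mathlib

open SimpleGraph

/-- The `k`-th spectral moment of a graph: the trace of the `k`-th power of its
adjacency matrix. -/
noncomputable def specMoment {V : Type*} [Fintype V] (G : SimpleGraph V) (k : ℕ) : ℝ :=
  letI := Classical.decEq V
  letI : DecidableRel G.Adj := Classical.decRel _
  Matrix.trace ((G.adjMatrix ℝ) ^ k)

/-- The strict lexicographic order by spectral moments (`S`-order) for graphs on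
`n` vertices. -/
def SLt {V W : Type*} [Fintype V] [Fintype W] (n : ℕ)
    (G : SimpleGraph V) (H : SimpleGraph W) : Prop :=
  ∃ k, 1 ≤ k ∧ k ≤ n - 1 ∧ (∀ i, i < k → specMoment G i = specMoment H i) ∧
    specMoment G k < specMoment H k

/-- The number of cut edges (bridges) of a graph. -/
noncomputable def numBridges {V : Type*} (G : SimpleGraph V) : ℕ :=
  {e : Sym2 V | G.IsBridge e}.ncard

/-- `KnOne n`: the `n`-vertex graph obtained from the complete graph `K_{n-1}`
(on the vertices `0, …, n-2`) by attaching the pendant vertex `n-1` to the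
vertex `0`; this is `K_n^1`. -/
def KnOne (n : ℕ) : SimpleGraph (Fin n) :=
  SimpleGraph.fromRel (fun i j =>
    ((i : ℕ) < n - 1 ∧ (j : ℕ) < n - 1) ∨ ((i : ℕ) = 0 ∧ (j : ℕ) = n - 1))

/-- `GTwo n`: the `n`-vertex graph obtained from the complete graph `K_{n-1}`
(on the vertices `0, …, n-2`) by deleting the edge `{1, 2}` and attaching the
pendant vertex `n-1` to the vertex `0` (which is distinct from `1` and `2`). -/
def GTwo (n : ℕ) : SimpleGraph (Fin n) :=
  SimpleGraph.fromRel (fun i j =>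
    ((i : ℕ) < n - 1 ∧ (j : ℕ) < n - 1 ∧
      ¬(((i : ℕ) = 1 ∧ (j : ℕ) = 2) ∨ ((i : ℕ) = 2 ∧ (j : ℕ) = 1))) ∨
    ((i : ℕ) = 0 ∧ (j : ℕ) = n - 1))


theorem specMoment_eq {V : Type*} [Fintype V] [DecidableEq V] (G : SimpleGraph V)
    [DecidableRel G.Adj] (k : ℕ) : specMoment G k = Matrix.trace ((G.adjMatrix ℝ) ^ k) := by
  unfold specMoment
  congr!

theorem specMoment_iso {V W : Type*} [Fintype V] [Fintype W] {G : SimpleGraph V}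
    {H : SimpleGraph W} (e : G ≃g H) (k : ℕ) : specMoment G k = specMoment H k := by
  classical
  rw [specMoment_eq, specMoment_eq]
  have h : H.adjMatrix ℝ = Matrix.reindexAlgEquiv ℝ ℝ e.toEquiv (G.adjMatrix ℝ) := by
    ext i j
    simp only [Matrix.reindexAlgEquiv_apply, Matrix.reindex_apply, Matrix.submatrix_apply,
      adjMatrix_apply]
    have : G.Adj (e.toEquiv.symm i) (e.toEquiv.symm j) ↔ H.Adj i j := e.symm.map_adj_iff
    simp [this]
  rw [h, ← map_pow]
  simp only [Matrix.trace, Matrix.diag, Matrix.reindexAlgEquiv_apply, Matrix.reindex_apply,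
      Matrix.submatrix_apply]
  exact (Equiv.sum_comp e.toEquiv.symm (fun i => (G.adjMatrix ℝ ^ k) i i)).symm

theorem specMoment_zero {V : Type*} [Fintype V] (G : SimpleGraph V) :
    specMoment G 0 = Fintype.card V := by
  classical
  rw [specMoment_eq]; simp

theorem specMoment_one {V : Type*} [Fintype V] (G : SimpleGraph V) :
    specMoment G 1 = 0 := by
  classical
  rw [specMoment_eq]; simp

open Classical in
theorem specMoment_two {V : Type*} [Fintype V] (G : SimpleGraph V) :
    specMoment G 2 = ((Finset.univ.filter (fun q : V × V => G.Adj q.1 q.2)).card : ℝ) := by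
  rw [specMoment_eq, pow_two, Finset.card_filter, Fintype.sum_prod_type]
  simp only [Matrix.trace, Matrix.diag, adjMatrix_mul_self_apply_self, Nat.cast_sum]
  refine Finset.sum_congr rfl fun i _ => ?_
  rw [← card_neighborFinset_eq_degree, neighborFinset_eq_filter, Finset.card_filter]
  push_cast
  rfl

theorem specMoment_two_lt {V : Type*} [Fintype V] {G H : SimpleGraph V} (h : G < H) :
    specMoment G 2 < specMoment H 2 := by
  classical
  rw [specMoment_two, specMoment_two, Nat.cast_lt]
  apply Finset.card_lt_card
  rw [Finset.ssubset_iff_of_subset]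
  · by_contra! hc
    apply h.not_ge
    intro a b hab
    simpa using hc (a, b) (by simpa using hab)
  · intro q; simp only [Finset.mem_filter, Finset.mem_univ, true_and]; exact fun hq => h.le hq

theorem SLt_of_two {n : ℕ} (hn : 5 ≤ n) {G H : SimpleGraph (Fin n)}
    (h : specMoment G 2 < specMoment H 2) : SLt n G H := by
  refine ⟨2, by omega, by omega, ?_, h⟩
  intro i hi
  interval_cases i
  · rw [specMoment_zero, specMoment_zero]
  · rw [specMoment_one, specMoment_one]

section pend
variable {V : Type*} [Fintype V] [DecidableEq V]

open Matrix in
theorem trace_pend (M : Matrix V V ℝ) (p r : V) (hpr : p ≠ r) (h1 : ∀ i, M p i = 0)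
    (h2 : ∀ i, M i p = 0) (hr : M r r = 0) :
    ((M + (single p r 1 + single r p 1)) ^ 2).trace = (M ^ 2).trace + 2 ∧
    ((M + (single p r 1 + single r p 1)) ^ 3).trace = (M ^ 3).trace ∧
    ((M + (single p r 1 + single r p 1)) ^ 4).trace = (M ^ 4).trace + 4 * (M * M) r r + 2 := by
  set P : Matrix V V ℝ := single p r 1 + single r p 1 with hP
  have hPP : P * P = single p p 1 + single r r 1 := by
    simp [hP, add_mul, mul_add, hpr, hpr.symm, add_comm]
  have hP3 : P * P * P = P := by
    rw [hPP, hP]; simp [add_mul, mul_add, hpr, hpr.symm]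
  have tP : P.trace = 0 := by simp [hP, hpr, hpr.symm]
  have tPP : (P * P).trace = 2 := by rw [hPP]; simp; norm_num
  have col : ∀ N : Matrix V V ℝ, ∀ i, (N * M) i p = 0 := by
    intro N i; simp [Matrix.mul_apply, h2]
  have row : ∀ N : Matrix V V ℝ, ∀ i, (M * N) p i = 0 := by
    intro N i; simp [Matrix.mul_apply, h1]
  have tNP : ∀ N : Matrix V V ℝ, (N * P).trace = N r p + N p r := by
    intro N; simp [hP, mul_add, trace_mul_single]
  have tNPP : ∀ N : Matrix V V ℝ, (N * (P * P)).trace = N p p + N r r := by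
    intro N; rw [hPP]; simp [mul_add, trace_mul_single]
  have t1 : (M * P).trace = 0 := by rw [tNP, h1, h2]; simp
  have t1' : (P * M).trace = 0 := by rw [trace_mul_comm, t1]
  have t2 : (M * M * P).trace = 0 := by rw [tNP, col, row]; simp
  have t3 : (M * M * M * P).trace = 0 := by rw [tNP, col, mul_assoc, row]; simp
  have t4 : (M * (P * P)).trace = 0 := by rw [tNPP, h1, hr]; simp
  have t5 : (M * M * (P * P)).trace = (M * M) r r := by rw [tNPP, col]; simp
  have MPM : M * P * M = 0 := by
    ext i j
    simp [hP, mul_add, Matrix.mul_apply, Matrix.single_apply, h1, h2,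
      ite_and]
  refine ⟨?_, ?_, ?_⟩
  · have : (M + P) ^ 2 = M ^ 2 + M * P + P * M + P * P := by noncomm_ring
    rw [this]; simp only [trace_add, t1, t1', tPP]; ring
  · have : (M + P) ^ 3 = M ^ 3 + M * M * P + M * P * M + P * (M * M) + M * (P * P) + P * M * P
      + (P * P) * M + P * P * P := by noncomm_ring
    rw [this]
    have e1 : (P * (M * M)).trace = 0 := by rw [trace_mul_comm, t2]
    have e2 : (P * M * P).trace = 0 := by rw [mul_assoc, trace_mul_comm, mul_assoc, t4]
    have e3 : (P * P * M).trace = 0 := by rw [trace_mul_comm, t4]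
    simp only [trace_add, t2, MPM, e1, t4, e2, e3, hP3, tP, trace_zero]; ring
  · have : (M + P) ^ 4 = M ^ 4 + (M * M * M * P + M * (M * P * M) + (M * P * M) * M + P * (M * M * M))
      + (M * M * (P * P) + (M * P * M) * P + M * (P * P) * M + P * (M * M) * P + P * (M * P * M)
        + P * P * (M * M)) + (M * (P * P * P) + P * (M * (P * P)) + (P * P) * (M * P) + (P * P * P) * M)
      + P * P * P * P := by noncomm_ring
    rw [this, MPM, hP3]
    have e1 : (P * (M * M * M)).trace = 0 := by rw [trace_mul_comm, t3]
    have e2 : (M * (P * P) * M).trace = (M * M) r r := by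
      rw [trace_mul_comm, ← mul_assoc, t5]
    have e3 : (P * (M * M) * P).trace = (M * M) r r := by
      rw [mul_assoc, trace_mul_comm, mul_assoc, t5]
    have e4 : (P * P * (M * M)).trace = (M * M) r r := by
      rw [trace_mul_comm, t5]
    have e5 : (P * (M * (P * P))).trace = 0 := by
      rw [trace_mul_comm, mul_assoc, hP3, t1]
    have e6 : (P * P * (M * P)).trace = 0 := by
      rw [trace_mul_comm, mul_assoc, ← mul_assoc P P P, hP3, t1]
    simp only [trace_add, t3, e1, e2, e3, e4, e5, e6, t5, t1, t1', tPP, trace_zero, mul_zero, zero_mul]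
    ring

/-- complete graph on `V \ {p}` minus the edge `xy`. -/
def baseG (p x y : V) : SimpleGraph V where
  Adj i j := i ≠ j ∧ i ≠ p ∧ j ≠ p ∧ ¬ (i = x ∧ j = y) ∧ ¬ (i = y ∧ j = x)
  symm := ⟨by intro i j h; tauto⟩
  loopless := ⟨by intro i h; exact h.1 rfl⟩

/-- `baseG` with the pendant vertex `p` attached at `r`. -/
def pendG (p r x y : V) : SimpleGraph V where
  Adj i j := i ≠ j ∧ ((i ≠ p ∧ j ≠ p ∧ ¬ (i = x ∧ j = y) ∧ ¬ (i = y ∧ j = x)) ∨ (i = p ∧ j = r) ∨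
    (i = r ∧ j = p))
  symm := ⟨by intro i j h; tauto⟩
  loopless := ⟨by intro i h; exact h.1 rfl⟩

open Matrix in
theorem moments_pendG (p r x y : V) (hpr : p ≠ r) (k : ℕ) [DecidableRel (baseG p x y).Adj] :
    specMoment (pendG p r x y) k =
      (((baseG p x y).adjMatrix ℝ + (single p r 1 + single r p 1)) ^ k).trace := by
  classical
  rw [specMoment_eq]
  congr 2
  ext i j
  rw [Matrix.add_apply, Matrix.add_apply, adjMatrix_apply, adjMatrix_apply]
  simp only [Matrix.single_apply, pendG, baseG]
  by_cases h1 : i = p <;> by_cases h2 : j = p <;> by_cases h3 : i = r <;> by_cases h4 : j = r <;>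
    simp_all [eq_comm]

/-- moving the pendant vertex. -/
theorem pend_compare (p r x y : V) (hpr : p ≠ r) (hpx : p ≠ x) (hpy : p ≠ y) (hxy : x ≠ y)
    (hrx : r ≠ x) (hry : r ≠ y) :
    specMoment (pendG p x x y) 2 = specMoment (pendG p r x y) 2 ∧
    specMoment (pendG p x x y) 3 = specMoment (pendG p r x y) 3 ∧
    specMoment (pendG p x x y) 4 < specMoment (pendG p r x y) 4 := by
  classical
  have H := fun s (hs : p ≠ s) => trace_pend ((baseG p x y).adjMatrix ℝ) p s hs
    (by intro i; simp [baseG]) (by intro i; simp [baseG]) (by simp)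
  simp only [moments_pendG p r x y hpr, moments_pendG p x x y hpx]
  obtain ⟨a1, a2, a3⟩ := H r hpr
  obtain ⟨b1, b2, b3⟩ := H x hpx
  refine ⟨by rw [a1, b1], by rw [a2, b2], ?_⟩
  rw [a3, b3, adjMatrix_mul_self_apply_self, adjMatrix_mul_self_apply_self]
  have : (baseG p x y).degree x < (baseG p x y).degree r := by
    rw [← card_neighborFinset_eq_degree, ← card_neighborFinset_eq_degree]
    have e1 : (baseG p x y).neighborFinset x = Finset.univ \ {x, y, p} := by
      ext i; rw [mem_neighborFinset]; simp only [baseG, Finset.mem_sdiff, Finset.mem_univ, Finset.mem_insert, Finset.mem_singleton]; clear H a1 a2 a3 b1 b2 b3; grind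
    have e2 : (baseG p x y).neighborFinset r = Finset.univ \ {r, p} := by
      ext i; rw [mem_neighborFinset]; simp only [baseG, Finset.mem_sdiff, Finset.mem_univ, Finset.mem_insert, Finset.mem_singleton]; clear H a1 a2 a3 b1 b2 b3; grind
    have c1 : ({x, y, p} : Finset V).card = 3 := by
      rw [Finset.card_eq_three]; exact ⟨x, y, p, hxy, hpx.symm, hpy.symm, rfl⟩
    have c2 : ({r, p} : Finset V).card = 2 := Finset.card_pair hpr.symm
    have c3 : ({x, y, p} : Finset V).card ≤ (Finset.univ : Finset V).card :=
      Finset.card_le_univ _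
    rw [e1, e2, Finset.card_sdiff_of_subset (Finset.subset_univ _),
      Finset.card_sdiff_of_subset (Finset.subset_univ _)]
    omega
  have : ((baseG p x y).degree x : ℝ) < (baseG p x y).degree r := by exact_mod_cast this
  linarith

/-- relabelling. -/
def pendIso (σ : Equiv.Perm V) (p r x y : V) :
    pendG p r x y ≃g pendG (σ p) (σ r) (σ x) (σ y) where
  toEquiv := σ
  map_rel_iff' := by intro i j; simp [pendG]

theorem pendG_symm (p r x y : V) : pendG p r x y = pendG p r y x := by
  ext i j; simp [pendG]; tauto

theorem exists_perm_three (a b c a' b' c' : V) (h1 : a ≠ b) (h2 : a ≠ c) (h3 : b ≠ c)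
    (h1' : a' ≠ b') (h2' : a' ≠ c') (h3' : b' ≠ c') :
    ∃ σ : Equiv.Perm V, σ a = a' ∧ σ b = b' ∧ σ c = c' := by
  obtain ⟨σ, hσ⟩ := Equiv.Perm.exists_extending_pair ![a, b, c] ![a', b', c']
    (by intro i j; fin_cases i <;> fin_cases j <;> simp_all [eq_comm])
    (by intro i j; fin_cases i <;> fin_cases j <;> simp_all [eq_comm])
  exact ⟨σ, hσ 0, hσ 1, hσ 2⟩

theorem exists_perm_four (a b c d a' b' c' d' : V) (h1 : a ≠ b) (h2 : a ≠ c) (h3 : b ≠ c)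
    (h4 : a ≠ d) (h5 : b ≠ d) (h6 : c ≠ d)
    (h1' : a' ≠ b') (h2' : a' ≠ c') (h3' : b' ≠ c') (h4' : a' ≠ d') (h5' : b' ≠ d') (h6' : c' ≠ d') :
    ∃ σ : Equiv.Perm V, σ a = a' ∧ σ b = b' ∧ σ c = c' ∧ σ d = d' := by
  obtain ⟨σ, hσ⟩ := Equiv.Perm.exists_extending_pair ![a, b, c, d] ![a', b', c', d']
    (by intro i j; fin_cases i <;> fin_cases j <;> simp_all [eq_comm])
    (by intro i j; fin_cases i <;> fin_cases j <;> simp_all [eq_comm])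
  exact ⟨σ, hσ 0, hσ 1, hσ 2, hσ 3⟩

/-- `K_n^1` with pendant vertex `p` at `r`. -/
def compG (p r : V) : SimpleGraph V where
  Adj i j := i ≠ j ∧ ((i ≠ p ∧ j ≠ p) ∨ (i = p ∧ j = r) ∨ (i = r ∧ j = p))
  symm := ⟨by intro i j h; tauto⟩
  loopless := ⟨by intro i h; exact h.1 rfl⟩

def compIso (σ : Equiv.Perm V) (p r : V) :
    compG p r ≃g compG (σ p) (σ r) where
  toEquiv := σ
  map_rel_iff' := by intro i j; simp [compG]

end pend

theorem KnOne_eq (n : ℕ) (hn : 5 ≤ n) :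
    KnOne n = compG (⟨n - 1, by omega⟩ : Fin n) ⟨0, by omega⟩ := by
  ext i j
  simp only [KnOne, compG, fromRel_adj, ne_eq, Fin.ext_iff]
  omega

theorem GTwo_eq (n : ℕ) (hn : 5 ≤ n) :
    GTwo n = pendG (⟨n - 1, by omega⟩ : Fin n) ⟨0, by omega⟩ ⟨1, by omega⟩ ⟨2, by omega⟩ := by
  ext i j
  simp only [GTwo, pendG, fromRel_adj, ne_eq, Fin.ext_iff]
  omega

theorem GTwo_lt_KnOne (n : ℕ) (hn : 5 ≤ n) : GTwo n < KnOne n := by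
  rw [lt_iff_le_not_ge]
  constructor
  · intro i j
    simp only [GTwo, KnOne, fromRel_adj, ne_eq, Fin.ext_iff]
    omega
  · intro h
    have h1 : (KnOne n).Adj ⟨1, by omega⟩ ⟨2, by omega⟩ := by
      simp only [KnOne, fromRel_adj, ne_eq, Fin.ext_iff]
      omega
    have h2 := h h1
    rw [GTwo_eq n hn] at h2
    simp [pendG, Fin.ext_iff] at h2

theorem GTwo_two (n : ℕ) (hn : 5 ≤ n) : (((n - 1) * (n - 2) : ℕ) : ℝ) ≤ specMoment (GTwo n) 2 := by
  classical
  rw [specMoment_two, Nat.cast_le, GTwo_eq n hn]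
  set p : Fin n := ⟨n - 1, by omega⟩ with hp
  set r : Fin n := ⟨0, by omega⟩ with hr
  set x : Fin n := ⟨1, by omega⟩ with hx
  set y : Fin n := ⟨2, by omega⟩ with hy
  have hpr : p ≠ r := by simp [hp, hr]; omega
  have hpx : p ≠ x := by simp [hp, hx]; omega
  have hpy : p ≠ y := by simp [hp, hy]; omega
  have hxy : x ≠ y := by simp [hy, hx]
  have hsub : ((Finset.univ.erase p).offDiag \ {(x, y), (y, x)}) ∪ {(p, r), (r, p)} ⊆
      Finset.univ.filter (fun q : Fin n × Fin n => (pendG p r x y).Adj q.1 q.2) := by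
    rintro ⟨i, j⟩
    simp only [Finset.mem_union, Finset.mem_sdiff, Finset.mem_offDiag, Finset.mem_erase,
      Finset.mem_univ, Finset.mem_insert, Finset.mem_singleton, Prod.mk.injEq, Finset.mem_filter,
      pendG]
    grind
  refine le_trans ?_ (Finset.card_le_card hsub)
  rw [Finset.card_union_of_disjoint, Finset.card_sdiff_of_subset, Finset.offDiag_card,
    Finset.card_erase_of_mem (Finset.mem_univ _), Finset.card_univ, Fintype.card_fin,
    Finset.card_pair, Finset.card_pair]
  · obtain ⟨m, rfl⟩ : ∃ m, n = m + 5 := ⟨n - 5, by omega⟩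
    have : (m + 5 - 1) * (m + 5 - 1) = (m + 5 - 1) * (m + 5 - 2) + (m + 4) := by
      simp only [Nat.add_sub_cancel, show m + 5 - 1 = m + 4 by omega, show m + 5 - 2 = m + 3 by omega]
      ring
    omega
  · simp [hpr]
  · simp [hxy]
  · intro q; simp only [Finset.mem_offDiag, Finset.mem_erase, Finset.mem_insert,
      Finset.mem_singleton]
    rintro (rfl | rfl) <;> simp [hpx.symm, hpy.symm, hxy, hxy.symm]
  · rw [Finset.disjoint_left]
    intro q; simp only [Finset.mem_sdiff, Finset.mem_offDiag, Finset.mem_erase, Finset.mem_insert,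
      Finset.mem_singleton]
    rintro h (rfl | rfl) <;> simp at h

theorem cut_two (n : ℕ) (hn : 5 ≤ n) (G : SimpleGraph (Fin n)) (A : Finset (Fin n)) (u v : Fin n)
    (hA : 2 ≤ A.card) (hB : 2 ≤ Aᶜ.card)
    (hc : ∀ i ∈ A, ∀ j ∉ A, G.Adj i j → i = u ∧ j = v) :
    specMoment G 2 < specMoment (GTwo n) 2 := by
  classical
  refine lt_of_lt_of_le ?_ (GTwo_two n hn)
  rw [specMoment_two, Nat.cast_lt]
  have hsub : Finset.univ.filter (fun q : Fin n × Fin n => G.Adj q.1 q.2) ⊆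
      (A.offDiag ∪ Aᶜ.offDiag) ∪ {(u, v), (v, u)} := by
    rintro ⟨i, j⟩
    simp only [Finset.mem_union, Finset.mem_offDiag, Finset.mem_compl,
      Finset.mem_univ, Finset.mem_insert, Finset.mem_singleton, Prod.mk.injEq, Finset.mem_filter]
    rintro ⟨-, h⟩
    have h1 := h.ne
    have h2 := hc i
    have h3 := hc j
    have h4 := h.symm
    grind
  have l1 := Finset.card_le_card hsub
  have l2 := Finset.card_union_le (A.offDiag ∪ Aᶜ.offDiag) {(u, v), (v, u)}
  have l3 := Finset.card_union_le A.offDiag Aᶜ.offDiag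
  have l4 : ({(u, v), (v, u)} : Finset (Fin n × Fin n)).card ≤ 2 := Finset.card_le_two
  rw [Finset.offDiag_card, Finset.offDiag_card] at l3
  have l5 : A.card + Aᶜ.card = n := by rw [Finset.card_add_card_compl, Fintype.card_fin]
  obtain ⟨a, ha⟩ : ∃ a, A.card = a + 2 := ⟨A.card - 2, by omega⟩
  obtain ⟨b, hb⟩ : ∃ b, Aᶜ.card = b + 2 := ⟨Aᶜ.card - 2, by omega⟩
  rw [ha, hb] at l3 l5
  have hab : 1 ≤ a + b := by omega
  subst l5
  have e1 : (a + 2) * (a + 2) - (a + 2) = a * a + 3 * a + 2 := by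
    rw [Nat.sub_eq_iff_eq_add] <;> nlinarith
  have e2 : (b + 2) * (b + 2) - (b + 2) = b * b + 3 * b + 2 := by
    rw [Nat.sub_eq_iff_eq_add] <;> nlinarith
  have e3 : (a + 2 + (b + 2) - 1) * (a + 2 + (b + 2) - 2) = (a + b + 3) * (a + b + 2) := by
    congr 1 <;> omega
  rw [e1, e2] at l3
  rw [e3]
  have : a * a + 3 * a + 2 + (b * b + 3 * b + 2) + 2 < (a + b + 3) * (a + b + 2) := by
    nlinarith [Nat.zero_le (a * b)]
  omega

theorem pendant_case (n : ℕ) (hn : 5 ≤ n) (G : SimpleGraph (Fin n)) (p r : Fin n)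
    (hG : G.Adj p r) (hp : ∀ j, G.Adj p j → j = r)
    (h1 : ¬ Nonempty (G ≃g KnOne n)) (h2 : ¬ Nonempty (G ≃g GTwo n)) : SLt n G (GTwo n) := by
  have hpr := hG.ne
  set p0 : Fin n := ⟨n - 1, by omega⟩ with hp0
  set r0 : Fin n := ⟨0, by omega⟩ with hr0
  set x0 : Fin n := ⟨1, by omega⟩ with hx0
  set y0 : Fin n := ⟨2, by omega⟩ with hy0
  have hpr0 : p0 ≠ r0 := by simp [hp0, hr0]; omega
  have hpx0 : p0 ≠ x0 := by simp [hp0, hx0]; omega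
  have hpy0 : p0 ≠ y0 := by simp [hp0, hy0]; omega
  have hxy0 : x0 ≠ y0 := by simp [hy0, hx0]
  have hrx0 : r0 ≠ x0 := by simp [hr0, hx0]
  have hry0 : r0 ≠ y0 := by simp [hr0, hy0]
  have hle : G ≤ compG p r := by
    intro i j hij
    have := hij.ne
    have := hp i
    have := hp j
    have := hij.symm
    simp only [compG]
    grind
  have hne : G ≠ compG p r := by
    intro h
    apply h1
    obtain ⟨y, hy, hyr⟩ : ∃ y : Fin n, y ≠ p ∧ y ≠ r := by
      have : ∃ y, y ∉ ({p, r} : Finset (Fin n)) := by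
        by_contra! hc
        have := Finset.card_le_card (fun y _ => hc y : Finset.univ ⊆ _)
        have h2 : ({p, r} : Finset (Fin n)).card ≤ 2 := Finset.card_le_two
        simp only [Finset.card_univ, Fintype.card_fin] at this
        omega
      obtain ⟨y, hy⟩ := this
      exact ⟨y, by simp at hy; tauto⟩
    obtain ⟨σ, e1, e2, -⟩ := exists_perm_three p r y p0 r0 x0 hpr hy.symm hyr.symm hpr0 hpx0 hrx0
    rw [h, KnOne_eq n hn]
    have := compIso σ p r
    rw [e1, e2] at this
    exact ⟨this⟩
  obtain ⟨x, y, hxy, hGxy⟩ : ∃ x y, (compG p r).Adj x y ∧ ¬ G.Adj x y := by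
    by_contra! hc
    exact hne (le_antisymm hle fun a b hab => hc a b hab)
  have nxy := hxy.ne
  have hxy' : x ≠ p ∧ y ≠ p := by
    have := hG.symm
    simp only [compG] at hxy
    grind
  obtain ⟨hxp, hyp⟩ := hxy'
  have hle2 : G ≤ pendG p r x y := by
    intro i j hij
    have h3 := hle hij
    have h4 := hij.symm
    simp only [compG, pendG] at h3 ⊢
    grind
  -- the case where the missing edge meets the attachment vertex
  have key : ∀ x y, x ≠ y → x ≠ p → y ≠ p → G ≤ pendG p x x y → SLt n G (GTwo n) := by
    intro x y nxy hxp hyp hle2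
    obtain ⟨σ, e1, e2, e3⟩ := exists_perm_three p x y p0 x0 y0 hxp.symm hyp.symm nxy
      hpx0 hpy0 hxy0
    have iso := pendIso σ p x x y
    rw [e1, e2, e3] at iso
    obtain ⟨c2, c3, c4⟩ := pend_compare p0 r0 x0 y0 hpr0 hpx0 hpy0 hxy0 hrx0 hry0
    rw [← specMoment_iso iso] at c2 c3 c4
    simp only [hp0, hr0, hx0, hy0, ← GTwo_eq n hn] at c2 c3 c4
    rcases hle2.eq_or_lt with h | h
    · refine ⟨4, by omega, by omega, ?_, h ▸ c4⟩
      intro i hi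
      interval_cases i
      · rw [specMoment_zero, specMoment_zero]
      · rw [specMoment_one, specMoment_one]
      · rw [h]; exact c2
      · rw [h]; exact c3
    · apply SLt_of_two hn
      rw [← c2]
      exact specMoment_two_lt h
  by_cases hrx : r = x
  · subst hrx
    exact key r y nxy hxp hyp hle2
  by_cases hry : r = y
  · subst hry
    rw [pendG_symm] at hle2
    exact key r x nxy.symm hyp hxp hle2
  obtain ⟨σ, e1, e2, e3, e4⟩ := exists_perm_four p r x y p0 r0 x0 y0 hpr hxp.symm hrx hyp.symm hry nxy
    hpr0 hpx0 hrx0 hpy0 hry0 hxy0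
  have iso := pendIso σ p r x y
  rw [e1, e2, e3, e4] at iso
  simp only [hp0, hr0, hx0, hy0, ← GTwo_eq n hn] at iso
  rcases hle2.eq_or_lt with h | h
  · exact absurd ⟨h ▸ iso⟩ h2
  · apply SLt_of_two hn
    rw [← specMoment_iso iso]
    exact specMoment_two_lt h

/-- For `n ≥ 5`, among connected graphs with `n` vertices and exactly one cut
edge, the second last graph in the `S`-order is obtained uniquely at `G_2`. -/
theorem second_last_one_cut_edge (n : ℕ) (hn : 5 ≤ n) :
    SLt n (GTwo n) (KnOne n) ∧
    ∀ G : SimpleGraph (Fin n), G.Connected → numBridges G = 1 →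
      ¬ Nonempty (G ≃g KnOne n) → ¬ Nonempty (G ≃g GTwo n) →
      SLt n G (GTwo n) := by
  classical
  refine ⟨SLt_of_two hn (specMoment_two_lt (GTwo_lt_KnOne n hn)), ?_⟩
  intro G hconn hbr h1 h2
  obtain ⟨e, he⟩ : {e : Sym2 (Fin n) | G.IsBridge e}.Nonempty := by
    apply Set.nonempty_of_ncard_ne_zero
    unfold numBridges at hbr
    omega
  induction e using Sym2.ind with
  | _ u v =>
  have he' : G.IsBridge s(u, v) := he
  have huv : G.Adj u v := he'.reachable_iff_adj.1 (hconn.preconnected u v)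
  rw [isBridge_iff] at he'
  set G' := G.deleteEdges {s(u, v)} with hG'
  set A : Finset (Fin n) := Finset.univ.filter (fun i => G'.Reachable u i) with hAdef
  have hmem : ∀ i, i ∈ A ↔ G'.Reachable u i := by intro i; simp [hAdef]
  have hu : u ∈ A := (hmem u).2 (Reachable.refl u)
  have hv : v ∉ A := fun h => he' ((hmem v).1 h)
  have hc : ∀ i ∈ A, ∀ j ∉ A, G.Adj i j → i = u ∧ j = v := by
    intro i hi j hj hij
    by_cases hs : s(i, j) = s(u, v)
    · rw [Sym2.eq_iff] at hs
      rcases hs with hs | hs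
      · exact hs
      · exact absurd (hs.1 ▸ hi) hv
    · exfalso
      apply hj
      have : G'.Adj i j := by
        rw [hG', deleteEdges_adj]
        exact ⟨hij, hs⟩
      exact (hmem j).2 (((hmem i).1 hi).trans this.reachable)
  by_cases hA : 2 ≤ A.card
  · by_cases hB : 2 ≤ Aᶜ.card
    · exact SLt_of_two hn (cut_two n hn G A u v hA hB hc)
    · have hone : ∀ j ∉ A, j = v := by
        intro j hj
        exact Finset.card_le_one.1 (by omega : Aᶜ.card ≤ 1) j (by simpa using hj) v
          (by simpa using hv)
      refine pendant_case n hn G v u huv.symm ?_ h1 h2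
      intro j hj
      by_cases hjA : j ∈ A
      · exact (hc j hjA v hv hj.symm).1
      · exact absurd (hone j hjA).symm hj.ne
  · have hone : ∀ j ∈ A, j = u := by
      intro j hj
      exact Finset.card_le_one.1 (by omega : A.card ≤ 1) j hj u hu
    refine pendant_case n hn G u v huv ?_ h1 h2
    intro j hj
    by_cases hjA : j ∈ A
    · exact absurd (hone j hjA).symm hj.ne
    · exact (hc u hu j hjA hj).2
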